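/- For every n ≥ 1, there are bijections between the set SP⁺(n) of Schröder paths of semilength n having no diagonal step on the diagonal, the set PT(n) of rooted planar trees with n+1 leaves in which every internal node has at least two children, and the set SP⁰(n) of Schröder paths of semilength n having at least one diagonal step on the diagonal. Consequently, the total number of Schröder paths of semilength n equals 2·|PT(n)|. -/

import Mathlib

/-! Schröder paths -/

inductive SStep : Type
  | H | V | D
deriving DecidableEq

def SStep.dx : SStep → ℕ
  | .H => 1 | .V => 0 | .D => 1

def SStep.dy : SStep → ℕ
  | .H => 0 | .V => 1 | .D => 1

def pathX (p : List SStep) : ℕ := (p.map SStep.dx).sum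
def pathY (p : List SStep) : ℕ := (p.map SStep.dy).sum

/-- A Schröder path of semilength `n`: from (0,0) to (n,n), steps H,V,D,
never rising above the diagonal. -/
def IsSchroder (n : ℕ) (p : List SStep) : Prop :=
  pathX p = n ∧ pathY p = n ∧ ∀ q : List SStep, q <+: p → pathY q ≤ pathX q

/-- No diagonal step starts on the diagonal. -/
def DiagFree (p : List SStep) : Prop :=
  ∀ q r : List SStep, p = q ++ SStep.D :: r → pathX q ≠ pathY q

/-- Every diagonal step is immediately followed by a horizontal step,
except if it is the last step. -/
def DFollowedByH (p : List SStep) : Prop :=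
  ∀ q r : List SStep, p = q ++ SStep.D :: r → r = [] ∨ ∃ r' : List SStep, r = SStep.H :: r'

def SP (n m : ℕ) : Type := {p : List SStep // IsSchroder n p ∧ p.count SStep.D + m = n}
def SPplus (n m : ℕ) : Type :=
  {p : List SStep // IsSchroder n p ∧ p.count SStep.D + m = n ∧ DiagFree p}
def SPzero (n m : ℕ) : Type :=
  {p : List SStep // IsSchroder n p ∧ p.count SStep.D + m = n ∧ ¬ DiagFree p}
def RP (n m : ℕ) : Type :=
  {p : List SStep // IsSchroder n p ∧ p.count SStep.D + m = n ∧ DFollowedByH p}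

/-! Rooted planar trees -/

inductive PTree : Type
  | node : List PTree → PTree

namespace PTree

def leaves : PTree → ℕ
  | node [] => 1
  | node (c :: cs) => ((c :: cs).attach.map fun x => leaves x.1).sum
decreasing_by
  have := List.sizeOf_lt_of_mem x.2
  simp only [PTree.node.sizeOf_spec, List.cons.sizeOf_spec] at this ⊢
  omega

def internal : PTree → ℕ
  | node [] => 0
  | node (c :: cs) => 1 + ((c :: cs).attach.map fun x => internal x.1).sum
decreasing_by
  have := List.sizeOf_lt_of_mem x.2
  simp only [PTree.node.sizeOf_spec, List.cons.sizeOf_spec] at this ⊢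
  omega

def Good : PTree → Prop
  | node cs => cs.length ≠ 1 ∧ ∀ c ∈ cs.attach, Good c.1
decreasing_by
  have := List.sizeOf_lt_of_mem c.2
  simp only [PTree.node.sizeOf_spec] at this ⊢
  omega

end PTree

def PT (n m : ℕ) : Type :=
  {t : PTree // t.Good ∧ t.leaves = n + 1 ∧ t.internal = m}

def PTn (n : ℕ) : Type := {t : PTree // t.Good ∧ t.leaves = n + 1}

/-! Motzkin paths -/

inductive MStep : Type
  | U | H | D
deriving DecidableEq

def MStep.dh : MStep → ℤ
  | .U => 1 | .H => 0 | .D => -1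

def mHeight (p : List MStep) : ℤ := (p.map MStep.dh).sum

def IsMotzkin (k : ℕ) (p : List MStep) : Prop :=
  p.length = k ∧ mHeight p = 0 ∧ ∀ q : List MStep, q <+: p → 0 ≤ mHeight q

def HFollowedByU (p : List MStep) : Prop :=
  ∀ q r : List MStep, p = q ++ MStep.H :: r → r = [] ∨ ∃ r' : List MStep, r = MStep.U :: r'

def MP (k : ℕ) : Type := {p : List MStep // IsMotzkin k p}
def RMP (k : ℕ) : Type := {p : List MStep // IsMotzkin k p ∧ HFollowedByU p}

/-- Motzkin steps with two possible colors on up and horizontal steps. -/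
inductive CMStep : Type
  | U : Bool → CMStep
  | H : Bool → CMStep
  | D : CMStep
deriving DecidableEq

def CMStep.forget : CMStep → MStep
  | .U _ => .U | .H _ => .H | .D => .D

/-- (h,u)-colored Motzkin paths of length n-1. -/
def huMP (n : ℕ) : Type := {p : List CMStep // IsMotzkin (n - 1) (p.map CMStep.forget)}


/-- All Schröder paths of semilength n. -/
def SPAll (n : ℕ) : Type := {p : List SStep // IsSchroder n p}

/-- Schröder paths of semilength n with no diagonal step on the diagonal. -/
def SPplusAll (n : ℕ) : Type := {p : List SStep // IsSchroder n p ∧ DiagFree p}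

/-- Schröder paths of semilength n with at least one diagonal step on the diagonal. -/
def SPzeroAll (n : ℕ) : Type := {p : List SStep // IsSchroder n p ∧ ¬ DiagFree p}

/-- `BalancedFrom h p`: started at height `h` above the axis, the path `p` stays weakly above the axis
and ends on it, where `H` goes up, `V` goes down and `D` is level. -/
def BalancedFrom (h : ℕ) : List SStep → Prop
  | [] => match h with
    | 0 => True
    | _ + 1 => False
  | .H :: p => BalancedFrom (h + 1) p
  | .V :: p => match h with
    | 0 => False
    | h + 1 => BalancedFrom h p
  | .D :: p => BalancedFrom h p

/-- `LevelFree h p`: started at height `h`, the path `p` has no `D` step at height `0`. -/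
def LevelFree : ℕ → List SStep → Prop
  | _, [] => True
  | h, .H :: p => LevelFree (h + 1) p
  | h, .V :: p => LevelFree (h - 1) p
  | h, .D :: p => h ≠ 0 ∧ LevelFree h p

@[simp] theorem pathX_nil : pathX [] = 0 := rfl

@[simp] theorem pathY_nil : pathY [] = 0 := rfl

@[simp] theorem pathX_cons (s : SStep) (p : List SStep) : pathX (s :: p) = s.dx + pathX p := by
  simp [pathX]

@[simp] theorem pathY_cons (s : SStep) (p : List SStep) : pathY (s :: p) = s.dy + pathY p := by
  simp [pathY]

@[simp] theorem pathX_append (p q : List SStep) : pathX (p ++ q) = pathX p + pathX q := by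
  simp [pathX]

theorem balanced_iff (h : ℕ) (p : List SStep) :
    BalancedFrom h p ↔ pathY p = h + pathX p ∧ ∀ q, q <+: p → pathY q ≤ h + pathX q := by
  induction p generalizing h with
  | nil => cases h <;> simp [BalancedFrom]
  | cons s p ih =>
    have key : (∀ q, q <+: s :: p → pathY q ≤ h + pathX q) ↔
        ∀ q, q <+: p → s.dy + pathY q ≤ h + (s.dx + pathX q) := by
      simp only [List.prefix_cons_iff]
      constructor
      · intro H q hq
        simpa using H (s :: q) (Or.inr ⟨q, rfl, hq⟩)
      · rintro H q (rfl | ⟨r, rfl, hr⟩)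
        · simp
        · simpa using H r hr
    rw [key]
    cases s with
    | H =>
      simp only [BalancedFrom, ih, pathX_cons, pathY_cons, SStep.dx, SStep.dy, zero_add, add_assoc]
    | D =>
      simp only [BalancedFrom, ih, pathX_cons, pathY_cons, SStep.dx, SStep.dy]
      refine and_congr (by omega) (forall₂_congr fun q _ => by omega)
    | V =>
      cases h with
      | zero =>
        simp only [BalancedFrom, SStep.dx, SStep.dy, false_iff, not_and]
        intro _ H
        simpa using H [] List.nil_prefix
      | succ h =>
        simp only [BalancedFrom, ih, pathX_cons, pathY_cons, SStep.dx, SStep.dy]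
        refine and_congr (by omega) (forall₂_congr fun q _ => by omega)

theorem isSchroder_iff (n : ℕ) (p : List SStep) :
    IsSchroder n p ↔ BalancedFrom 0 p ∧ pathX p = n := by
  simp only [IsSchroder, balanced_iff, zero_add]
  constructor
  · rintro ⟨h₁, h₂, h₃⟩
    exact ⟨⟨by omega, h₃⟩, h₁⟩
  · rintro ⟨⟨h₁, h₂⟩, h₃⟩
    exact ⟨h₃, by omega, h₂⟩

theorem levelFree_iff {h : ℕ} {p : List SStep} (hp : BalancedFrom h p) :
    LevelFree h p ↔ ∀ q r, p = q ++ SStep.D :: r → h + pathX q ≠ pathY q := by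
  induction p generalizing h with
  | nil => simp [LevelFree]
  | cons s p ih =>
    have key : (∀ q r, s :: p = q ++ SStep.D :: r → h + pathX q ≠ pathY q) ↔
        (s = .D → h ≠ 0) ∧
          ∀ q r, p = q ++ SStep.D :: r → h + (s.dx + pathX q) ≠ s.dy + pathY q := by
      constructor
      · intro H
        refine ⟨?_, fun q r e => ?_⟩
        · rintro rfl
          simpa using H [] p rfl
        · simpa using H (s :: q) r (by simp [e])
      · rintro ⟨H₁, H₂⟩ q r e
        cases q with
        | nil =>
          simp only [List.nil_append, List.cons.injEq] at e
          simpa using H₁ e.1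
        | cons s' q =>
          simp only [List.cons_append, List.cons.injEq] at e
          obtain ⟨rfl, e⟩ := e
          simpa using H₂ q r e
    rw [key]
    cases s with
    | H => simp [LevelFree, ih (h := h + 1) hp, SStep.dx, SStep.dy, add_assoc]
    | D =>
      simp only [LevelFree, ih (h := h) hp, SStep.dx, SStep.dy, forall_const]
      refine and_congr Iff.rfl (forall₃_congr fun q r _ => by omega)
    | V =>
      cases h with
      | zero => exact hp.elim
      | succ h =>
        simp only [LevelFree, Nat.add_sub_cancel, ih (h := h) hp, SStep.dx, SStep.dy, reduceCtorEq,
          false_imp_iff, true_and]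
        refine forall₃_congr fun q r _ => by omega

theorem diagFree_iff {p : List SStep} (hp : BalancedFrom 0 p) : DiagFree p ↔ LevelFree 0 p := by
  simp [DiagFree, levelFree_iff hp]

theorem BalancedFrom.append {j h : ℕ} {a b : List SStep} (ha : BalancedFrom j a) (hb : BalancedFrom h b) :
    BalancedFrom (j + h) (a ++ b) := by
  induction a generalizing j with
  | nil =>
    cases j with
    | zero => simpa using hb
    | succ j => exact ha.elim
  | cons s a ih =>
    cases s with
    | H =>
      have := ih (j := j + 1) ha
      rwa [add_right_comm] at this
    | D => exact ih (j := j) ha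
    | V =>
      cases j with
      | zero => exact ha.elim
      | succ j =>
        rw [add_right_comm]
        exact ih (j := j) ha

theorem BalancedFrom.exists_eq_append {j h : ℕ} {p : List SStep} (hp : BalancedFrom (j + h + 1) p) :
    ∃ a b, p = a ++ .V :: b ∧ BalancedFrom j a ∧ BalancedFrom h b := by
  induction p generalizing j with
  | nil => exact hp.elim
  | cons s p ih =>
    cases s with
    | H =>
      obtain ⟨a, b, rfl, ha, hb⟩ := ih (j := j + 1) (by rw [add_right_comm j 1 h]; exact hp)
      exact ⟨.H :: a, b, rfl, ha, hb⟩
    | D =>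
      obtain ⟨a, b, rfl, ha, hb⟩ := ih (j := j) hp
      exact ⟨.D :: a, b, rfl, by simpa [BalancedFrom] using ha, hb⟩
    | V =>
      cases j with
      | zero => exact ⟨[], p, rfl, trivial, by simpa [BalancedFrom] using hp⟩
      | succ j =>
        obtain ⟨a, b, rfl, ha, hb⟩ := ih (j := j) (by rw [add_right_comm j 1 h] at hp; exact hp)
        exact ⟨.V :: a, b, rfl, ha, hb⟩

theorem BalancedFrom.append_V_inj {j : ℕ} {a a' b b' : List SStep} (ha : BalancedFrom j a)
    (ha' : BalancedFrom j a') (e : a ++ .V :: b = a' ++ .V :: b') : a = a' ∧ b = b' := by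
  induction a generalizing j a' with
  | nil =>
    cases j with
    | succ j => exact ha.elim
    | zero =>
      cases a' with
      | nil => simpa using e
      | cons s a' =>
        obtain ⟨rfl, -⟩ : SStep.V = s ∧ _ := by simpa using e
        exact ha'.elim
  | cons s a ih =>
    cases a' with
    | nil =>
      obtain ⟨rfl, -⟩ : s = SStep.V ∧ _ := by simpa using e
      cases j
      · exact ha.elim
      · exact ha'.elim
    | cons s' a' =>
      obtain ⟨rfl, e'⟩ : s = s' ∧ a ++ .V :: b = a' ++ .V :: b' := by simpa using e
      have : a = a' ∧ b = b' := by
        cases s with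
        | H => exact ih (j := j + 1) ha ha' e'
        | D => exact ih (j := j) (by simpa [BalancedFrom] using ha) (by simpa [BalancedFrom] using ha') e'
        | V =>
          cases j with
          | zero => exact ha.elim
          | succ j => exact ih (j := j) ha ha' e'
      simpa using this

theorem BalancedFrom.levelFree_append {j : ℕ} {a b : List SStep} (ha : BalancedFrom j a) :
    LevelFree j (a ++ b) ↔ LevelFree j a ∧ LevelFree 0 b := by
  induction a generalizing j with
  | nil =>
    cases j with
    | zero => simp [LevelFree]
    | succ j => exact ha.elim
  | cons s a ih =>
    cases s with
    | H => exact ih (j := j + 1) ha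
    | D =>
      have := ih (j := j) (by simpa [BalancedFrom] using ha)
      simp [LevelFree, this, and_assoc]
    | V =>
      cases j with
      | zero => exact ha.elim
      | succ j => exact ih (j := j) ha

theorem BalancedFrom.levelFree_append_V {j : ℕ} {a b : List SStep} (ha : BalancedFrom j a) :
    LevelFree (j + 1) (a ++ .V :: b) ↔ LevelFree 0 b := by
  induction a generalizing j with
  | nil =>
    cases j with
    | zero => simp [LevelFree]
    | succ j => exact ha.elim
  | cons s a ih =>
    cases s with
    | H => exact ih (j := j + 1) ha
    | D =>
      have := ih (j := j) (by simpa [BalancedFrom] using ha)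
      simp [LevelFree, this]
    | V =>
      cases j with
      | zero => exact ha.elim
      | succ j => exact ih (j := j) ha

theorem BalancedFrom.not_levelFree_append_D {a b : List SStep} (ha : BalancedFrom 0 a) :
    ¬ LevelFree 0 (a ++ .D :: b) := by
  simp [ha.levelFree_append, LevelFree]

theorem BalancedFrom.append_D_inj {a a' b b' : List SStep} (ha : BalancedFrom 0 a) (ha' : BalancedFrom 0 a')
    (hf : LevelFree 0 a) (hf' : LevelFree 0 a') (e : a ++ .D :: b = a' ++ .D :: b') :
    a = a' ∧ b = b' := by
  rcases List.append_eq_append_iff.1 e with ⟨c, rfl, hc⟩ | ⟨c, rfl, hc⟩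
  · cases c with
    | nil => simpa using hc
    | cons s c =>
      obtain ⟨rfl, -⟩ : SStep.D = s ∧ _ := by simpa using hc
      exact (ha.not_levelFree_append_D hf').elim
  · cases c with
    | nil => simpa [eq_comm] using hc
    | cons s c =>
      obtain ⟨rfl, -⟩ : SStep.D = s ∧ _ := by simpa using hc
      exact (ha'.not_levelFree_append_D hf).elim

namespace PTree

theorem induction_children {P : PTree → Prop} (h : ∀ cs, (∀ c ∈ cs, P c) → P (node cs)) :
    ∀ t, P t
  | node cs => h cs fun c _ => induction_children h c

theorem leaves_node {cs : List PTree} (h : cs ≠ []) : (node cs).leaves = (cs.map leaves).sum := by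
  cases cs with
  | nil => exact (h rfl).elim
  | cons c cs =>
    rw [leaves, List.attach_map_val (l := c :: cs) (f := leaves)]

theorem good_node (cs : List PTree) : (node cs).Good ↔ cs.length ≠ 1 ∧ ∀ c ∈ cs, c.Good := by
  rw [Good]
  simp

mutual

/-- The path of a tree: a leaf gives the empty path, and a tree with first child `c` and further
children `cs` gives `H p V q` with `p` the path of the forest `cs` and `q` the path of `c`. -/
def toPath : PTree → List SStep
  | node [] => []
  | node (c :: cs) => .H :: (forestToPath cs ++ .V :: toPath c)

/-- The path of a forest: the paths of its trees, separated by `D` steps. -/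
def forestToPath : List PTree → List SStep
  | [] => []
  | [t] => toPath t
  | t :: u :: f => toPath t ++ .D :: forestToPath (u :: f)

end

theorem balanced_forestToPath {f : List PTree} (h : ∀ t ∈ f, BalancedFrom 0 t.toPath) :
    BalancedFrom 0 (forestToPath f) := by
  induction f with
  | nil => simp [forestToPath, BalancedFrom]
  | cons t f ih =>
    cases f with
    | nil => simpa [forestToPath] using h
    | cons u f =>
      rw [forestToPath]
      refine (h t (by simp)).append (h := 0) ?_
      simpa [BalancedFrom] using ih fun c hc => h c (List.mem_cons_of_mem _ hc)

theorem balanced_toPath (t : PTree) : BalancedFrom 0 t.toPath := by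
  induction t using induction_children with
  | h cs ih =>
    cases cs with
    | nil => simp [toPath, BalancedFrom]
    | cons c cs =>
      rw [toPath]
      have hcs := balanced_forestToPath fun t ht => ih t (List.mem_cons_of_mem _ ht)
      have hc : BalancedFrom 1 (.V :: c.toPath) := ih c (by simp)
      simpa [BalancedFrom] using hcs.append hc

theorem levelFree_toPath (t : PTree) : LevelFree 0 t.toPath := by
  induction t using induction_children with
  | h cs ih =>
    cases cs with
    | nil => simp [toPath, LevelFree]
    | cons c cs =>
      have hcs := balanced_forestToPath (f := cs) fun t _ => balanced_toPath t
      rw [toPath, LevelFree, hcs.levelFree_append_V]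
      exact ih c (by simp)

theorem not_levelFree_forestToPath (t u : PTree) (f : List PTree) :
    ¬ LevelFree 0 (forestToPath (t :: u :: f)) := by
  rw [forestToPath]
  exact (balanced_toPath t).not_levelFree_append_D

theorem pathX_forestToPath {f : List PTree} (hf : f ≠ [])
    (h : ∀ t ∈ f, pathX t.toPath + 1 = t.leaves) :
    pathX (forestToPath f) + 1 = (f.map leaves).sum := by
  induction f with
  | nil => exact (hf rfl).elim
  | cons t f ih =>
    have ht := h t (by simp)
    cases f with
    | nil => simpa [forestToPath] using ht
    | cons u f =>
      have := ih (by simp) fun c hc => h c (List.mem_cons_of_mem _ hc)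
      rw [forestToPath, List.map_cons, List.sum_cons, ← this, ← ht]
      simp only [pathX_append, pathX_cons, SStep.dx]
      omega

theorem pathX_toPath {t : PTree} (ht : t.Good) : pathX t.toPath + 1 = t.leaves := by
  induction t using induction_children with
  | h cs ih =>
    rw [good_node] at ht
    match cs with
    | [] => simp [toPath, leaves]
    | [c] => simp at ht
    | c :: d :: cs =>
      have hc := ih c (by simp) (ht.2 c (by simp))
      have hcs := pathX_forestToPath (f := d :: cs) (by simp) fun u hu =>
        ih u (List.mem_cons_of_mem _ hu) (ht.2 u (List.mem_cons_of_mem _ hu))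
      rw [leaves_node (by simp), List.map_cons, List.sum_cons, ← hc, ← hcs, toPath]
      simp only [pathX_append, pathX_cons, SStep.dx]
      omega

theorem forestToPath_inj {f g : List PTree} (hf : f ≠ []) (hg : g ≠ [])
    (h : ∀ t ∈ f, ∀ u ∈ g, t.toPath = u.toPath → t = u)
    (e : forestToPath f = forestToPath g) : f = g := by
  induction f generalizing g with
  | nil => exact (hf rfl).elim
  | cons t f ih =>
    match f, g with
    | _, [] => exact (hg rfl).elim
    | [], [u] => simpa using h t (by simp) u (by simp) (by simpa [forestToPath] using e)
    | [], u :: u' :: g =>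
      refine (not_levelFree_forestToPath u u' g ?_).elim
      rw [← e, forestToPath]
      exact levelFree_toPath t
    | t' :: f, [u] =>
      refine (not_levelFree_forestToPath t t' f ?_).elim
      rw [e, forestToPath]
      exact levelFree_toPath u
    | t' :: f, u :: u' :: g =>
      rw [forestToPath, forestToPath] at e
      obtain ⟨e₁, e₂⟩ := (balanced_toPath t).append_D_inj (balanced_toPath u)
        (levelFree_toPath t) (levelFree_toPath u) e
      rw [h t (by simp) u (by simp) e₁, ih (by simp) (by simp)
        (fun a ha b hb => h a (List.mem_cons_of_mem _ ha) b (List.mem_cons_of_mem _ hb)) e₂]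

theorem toPath_inj {t u : PTree} (ht : t.Good) (hu : u.Good) (e : t.toPath = u.toPath) :
    t = u := by
  induction t using induction_children generalizing u with
  | h cs ih =>
    obtain ⟨ds⟩ := u
    rw [good_node] at ht hu
    match cs, ds with
    | [], [] => rfl
    | [], d :: ds => simp [toPath] at e
    | c :: cs, [] => simp [toPath] at e
    | [c], _ => simp at ht
    | _, [d] => simp at hu
    | c :: c' :: cs, d :: d' :: ds =>
      rw [toPath, toPath, List.cons.injEq] at e
      obtain ⟨e₁, e₂⟩ := (balanced_forestToPath fun t _ => balanced_toPath t).append_V_inj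
        (balanced_forestToPath fun t _ => balanced_toPath t) e.2
      rw [ih c (by simp) (ht.2 c (by simp)) (hu.2 d (by simp)) e₂,
        forestToPath_inj (by simp) (by simp) (fun a ha b hb =>
          ih a (List.mem_cons_of_mem _ ha) (ht.2 a (List.mem_cons_of_mem _ ha))
            (hu.2 b (List.mem_cons_of_mem _ hb))) e₁]

theorem exists_forestToPath_eq (p : List SStep) (hp : BalancedFrom 0 p) :
    ∃ t f, (∀ u ∈ t :: f, Good u) ∧ forestToPath (t :: f) = p := by
  induction hl : p.length using Nat.strong_induction_on generalizing p with
  | _ l ih =>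
    have leaf_good : (node []).Good := by simp [good_node]
    match p with
    | [] => exact ⟨node [], [], by simpa using leaf_good, by simp [forestToPath, toPath]⟩
    | .V :: p => exact hp.elim
    | .D :: p =>
      obtain ⟨t, f, hf, rfl⟩ := ih p.length (by simp [← hl]) p hp rfl
      exact ⟨node [], t :: f, List.forall_mem_cons.2 ⟨leaf_good, hf⟩,
        by simp [forestToPath, toPath]⟩
    | .H :: p =>
      obtain ⟨a, b, rfl, ha, hb⟩ := BalancedFrom.exists_eq_append (j := 0) (h := 0) hp
      simp only [List.length_cons, List.length_append] at hl
      obtain ⟨t, f, hf, rfl⟩ := ih a.length (by omega) a ha rfl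
      obtain ⟨u, g, hg, rfl⟩ := ih b.length (by omega) b hb rfl
      rw [List.forall_mem_cons] at hg
      refine ⟨node (u :: t :: f), g, List.forall_mem_cons.2 ⟨?_, hg.2⟩, ?_⟩
      · rw [good_node]
        exact ⟨by simp, List.forall_mem_cons.2 ⟨hg.1, hf⟩⟩
      · cases g <;> simp [forestToPath, toPath]

/-- The children of the root. -/
def children : PTree → List PTree
  | node cs => cs

theorem exists_children_eq {t : PTree} (ht : t.Good) {n : ℕ} (hn : 1 ≤ n)
    (hl : t.leaves = n + 1) :
    ∃ c d cs, t = node (c :: d :: cs) := by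
  obtain ⟨cs⟩ := t
  rw [good_node] at ht
  match cs with
  | [] =>
    rw [leaves] at hl
    omega
  | [c] => simp at ht
  | c :: d :: cs => exact ⟨c, d, cs, rfl⟩

end PTree

open PTree in
/-- Trees with `n + 1` leaves correspond to paths without `D` steps on the diagonal. -/
noncomputable def treeEquivSPplus (n : ℕ) : PTn n ≃ SPplusAll n :=
  Equiv.ofBijective
    (fun t => ⟨t.1.toPath, (isSchroder_iff _ _).2 ⟨balanced_toPath _, by
      have := pathX_toPath t.2.1
      have := t.2.2
      omega⟩, (diagFree_iff (balanced_toPath _)).2 (levelFree_toPath _)⟩) <| by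
    constructor
    · intro t u e
      exact Subtype.ext (toPath_inj t.2.1 u.2.1 (congrArg Subtype.val e))
    · rintro ⟨p, hp, hf⟩
      rw [isSchroder_iff] at hp
      rw [diagFree_iff hp.1] at hf
      obtain ⟨t, f, hg, rfl⟩ := exists_forestToPath_eq p hp.1
      cases f with
      | cons u f => exact (not_levelFree_forestToPath t u f hf).elim
      | nil =>
        have ht : t.Good := hg t (by simp)
        have hX := pathX_toPath ht
        have hp₂ := hp.2
        rw [forestToPath] at hp₂
        exact ⟨⟨t, ht, by omega⟩, Subtype.ext (by simp [forestToPath])⟩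

open PTree in
/-- Trees with `n + 1 ≥ 2` leaves correspond to paths with a `D` step on the diagonal. -/
noncomputable def treeEquivSPzero (n : ℕ) (hn : 1 ≤ n) : PTn n ≃ SPzeroAll n :=
  have balanced (f : List PTree) : BalancedFrom 0 (forestToPath f) :=
    balanced_forestToPath fun t _ => balanced_toPath t
  have pathX_eq {c d : PTree} {cs : List PTree} (h : ∀ u ∈ c :: d :: cs, u.Good) :
      pathX (forestToPath (c :: d :: cs)) + 1 = (node (c :: d :: cs)).leaves := by
    rw [leaves_node (by simp), pathX_forestToPath (by simp) fun u hu => pathX_toPath (h u hu)]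
  Equiv.ofBijective
    (fun t => ⟨forestToPath t.1.children, by
      obtain ⟨t, ht, hl⟩ := t
      obtain ⟨c, d, cs, rfl⟩ := exists_children_eq ht hn hl
      have hX := pathX_eq ((good_node _).1 ht).2
      rw [isSchroder_iff, diagFree_iff (balanced _)]
      exact ⟨⟨balanced _, by simp only [children]; omega⟩, not_levelFree_forestToPath c d cs⟩⟩) <| by
    constructor
    · rintro ⟨t, ht, hl⟩ ⟨u, hu, hl'⟩ e
      have e : forestToPath t.children = forestToPath u.children := congrArg Subtype.val e
      refine Subtype.ext ?_
      obtain ⟨c, d, cs, rfl⟩ := exists_children_eq ht hn hl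
      obtain ⟨c', d', cs', rfl⟩ := exists_children_eq hu hn hl'
      rw [good_node] at ht hu
      exact congrArg node (forestToPath_inj (by simp) (by simp)
        (fun a ha b hb => toPath_inj (ht.2 a ha) (hu.2 b hb)) e)
    · rintro ⟨p, hp, hf⟩
      rw [isSchroder_iff] at hp
      rw [diagFree_iff hp.1] at hf
      obtain ⟨t, f, hg, rfl⟩ := exists_forestToPath_eq p hp.1
      cases f with
      | nil =>
        rw [forestToPath] at hf
        exact (hf (levelFree_toPath t)).elim
      | cons u f =>
        have hX := pathX_eq hg
        exact ⟨⟨node (t :: u :: f), (good_node _).2 ⟨by simp, hg⟩, by omega⟩, rfl⟩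

open scoped Classical in
/-- A Schröder path either has no `D` step on the diagonal, or has one. -/
noncomputable def sumEquivSPAll (n : ℕ) : SPplusAll n ⊕ SPzeroAll n ≃ SPAll n :=
  (Equiv.sumCongr (Equiv.subtypeSubtypeEquivSubtypeInter (IsSchroder n) DiagFree)
    (Equiv.subtypeSubtypeEquivSubtypeInter (IsSchroder n) fun p => ¬ DiagFree p)).symm.trans
    (Equiv.sumCompl fun p : {p // IsSchroder n p} => DiagFree p.1)

/-- SP⁺(n) ≃ PT(n) ≃ SP⁰(n), and |SP(n)| = 2·|PT(n)|. -/
theorem statement6 (n : ℕ) (hn : 1 ≤ n) :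
    Nonempty (SPplusAll n ≃ PTn n) ∧ Nonempty (PTn n ≃ SPzeroAll n) ∧
      Nat.card (SPAll n) = 2 * Nat.card (PTn n) := by
  refine ⟨⟨(treeEquivSPplus n).symm⟩, ⟨treeEquivSPzero n hn⟩, ?_⟩
  have e : Bool × PTn n ≃ SPAll n :=
    (Equiv.boolProdEquivSum _).trans
      (((treeEquivSPplus n).sumCongr (treeEquivSPzero n hn)).trans (sumEquivSPAll n))
  rw [← Nat.card_congr e, Nat.card_prod]
  simp
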